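/- arXiv:1409.1905 — 6 statements merged into one kernel-verified Lean document; each statement's English description precedes it below -/
import Mathlib

section
/- Let (𝒫,𝒬,σ) and (𝒫̃,𝒬̃,σ̃) be elements of B_n, and suppose there exists a bijection τ̃: 𝒫 → 𝒫̃ such that max over P ∈ 𝒫 of max(‖P − τ̃(P)‖, ‖σ(P) − σ̃(τ̃(P))‖) < 1/2. Then d((𝒫,𝒬,σ),(𝒫̃,𝒬̃,σ̃)) equals this maximum, and τ̃ is the unique bijection realizing the minimum in the definition of d: for every bijection τ: 𝒫 → 𝒫̃ with τ ≠ τ̃, the quantity max over P ∈ 𝒫 of max(‖P − τ(P)‖, ‖σ(P) − σ̃(τ(P))‖) is strictly greater than d((𝒫,𝒬,σ),(𝒫̃,𝒬̃,σ̃)). -/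
noncomputable section

abbrev Mat (n : ℕ) : Type := Matrix (Fin n) (Fin n) ℂ

/-- Operator norm on matrices induced by the Euclidean norm on `ℂⁿ`. -/
noncomputable def opNorm {n : ℕ} (A : Mat n) : ℝ :=
  ‖(Matrix.toEuclideanCLM (𝕜 := ℂ) (n := Fin n)) A‖

/-- An orthogonal decomposition of `ℂⁿ`: a set of `n` pairwise orthogonal rank-one
orthogonal projections summing to the identity. -/
structure OrthDecomp (n : ℕ) where
  carrier : Finset (Mat n)
  card_eq : carrier.card = n
  herm : ∀ P ∈ carrier, P.conjTranspose = P
  idem : ∀ P ∈ carrier, P * P = P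
  rank_one : ∀ P ∈ carrier, P.rank = 1
  orth : ∀ P ∈ carrier, ∀ Q ∈ carrier, P ≠ Q → P * Q = 0
  sum_eq : (∑ P ∈ carrier, P) = 1

/-- The space `B_n` of triples `(𝒫, 𝒬, σ)`. -/
structure Bn (n : ℕ) where
  decA : OrthDecomp n
  decB : OrthDecomp n
  bij : {M // M ∈ decA.carrier} ≃ {M // M ∈ decB.carrier}

/-- The quantity `max_{P ∈ 𝒫} max(‖P − τ(P)‖, ‖σ(P) − σ̃(τ(P))‖)` for a bijection `τ`. -/
noncomputable def tripVal {n : ℕ} (a b : Bn n)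
    (τ : {M // M ∈ a.decA.carrier} ≃ {M // M ∈ b.decA.carrier}) : ℝ :=
  ⨆ P : {M // M ∈ a.decA.carrier},
    max (opNorm ((P : Mat n) - (τ P : Mat n)))
        (opNorm ((a.bij P : Mat n) - (b.bij (τ P) : Mat n)))

/-- The distance function `d` on `B_n`. -/
noncomputable def Bdist {n : ℕ} (a b : Bn n) : ℝ :=
  ⨅ τ : {M // M ∈ a.decA.carrier} ≃ {M // M ∈ b.decA.carrier}, tripVal a b τ

theorem opNorm_sub_le_add {n : ℕ} (A B C : Mat n) :
    opNorm (B - C) ≤ opNorm (A - B) + opNorm (A - C) := by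
  have hBC : B - C = (A - C) - (A - B) := by abel
  unfold opNorm
  rw [hBC, map_sub, add_comm]
  exact norm_sub_le _ _

theorem opNorm_mul_le {n : ℕ} (A B : Mat n) : opNorm (A * B) ≤ opNorm A * opNorm B := by
  unfold opNorm
  rw [map_mul]
  exact norm_mul_le _ _

theorem opNorm_pos {n : ℕ} {A : Mat n} (hA : A ≠ 0) : 0 < opNorm A :=
  norm_pos_iff.2 ((map_ne_zero_iff _ (Matrix.toEuclideanCLM (𝕜 := ℂ) (n := Fin n)).injective).2 hA)

/-- Distinct members of an orthogonal decomposition are at distance at least one. -/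
theorem OrthDecomp.one_le_opNorm_sub {n : ℕ} (D : OrthDecomp n) {P Q : Mat n}
    (hP : P ∈ D.carrier) (hQ : Q ∈ D.carrier) (hPQ : P ≠ Q) : 1 ≤ opNorm (P - Q) := by
  have hP0 : P ≠ 0 := by
    rintro rfl
    simpa using D.rank_one 0 hP
  have hmul : (P - Q) * P = P := by
    rw [sub_mul, D.idem P hP, D.orth Q hQ P hP hPQ.symm, sub_zero]
  have hle := opNorm_mul_le (P - Q) P
  rw [hmul] at hle
  exact le_of_mul_le_mul_right (by simpa using hle) (opNorm_pos hP0)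

theorem opNorm_sub_le_tripVal {n : ℕ} (a b : Bn n)
    (τ : {M // M ∈ a.decA.carrier} ≃ {M // M ∈ b.decA.carrier})
    (P : {M // M ∈ a.decA.carrier}) :
    opNorm ((P : Mat n) - (τ P : Mat n)) ≤ tripVal a b τ :=
  (le_max_left _ _).trans
    (le_ciSup (f := fun P : {M // M ∈ a.decA.carrier} =>
      max (opNorm ((P : Mat n) - (τ P : Mat n)))
        (opNorm ((a.bij P : Mat n) - (b.bij (τ P) : Mat n))))
      (Set.finite_range _).bddAbove P)

/-- Two distinct bijections have values adding up to at least one. -/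
theorem one_le_tripVal_add_tripVal {n : ℕ} (a b : Bn n)
    {τ τ' : {M // M ∈ a.decA.carrier} ≃ {M // M ∈ b.decA.carrier}} (hne : τ ≠ τ') :
    1 ≤ tripVal a b τ + tripVal a b τ' := by
  obtain ⟨P, hP⟩ := DFunLike.ne_iff.1 hne
  calc (1 : ℝ) ≤ opNorm ((τ P : Mat n) - (τ' P : Mat n)) :=
        b.decA.one_le_opNorm_sub (τ P).2 (τ' P).2 (Subtype.coe_ne_coe.2 hP)
    _ ≤ opNorm ((P : Mat n) - (τ P : Mat n)) + opNorm ((P : Mat n) - (τ' P : Mat n)) :=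
        opNorm_sub_le_add _ _ _
    _ ≤ tripVal a b τ + tripVal a b τ' :=
        add_le_add (opNorm_sub_le_tripVal a b τ P) (opNorm_sub_le_tripVal a b τ' P)

/-- a bijection achieving value `< 1/2` realizes the minimum in the
definition of `d`, and is the unique bijection doing so. -/
theorem realizes_min_of_lt_half {n : ℕ} (hn : 1 ≤ n) (a b : Bn n)
    (τ' : {M // M ∈ a.decA.carrier} ≃ {M // M ∈ b.decA.carrier})
    (h : tripVal a b τ' < 1 / 2) :
    Bdist a b = tripVal a b τ' ∧
    ∀ τ : {M // M ∈ a.decA.carrier} ≃ {M // M ∈ b.decA.carrier},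
      τ ≠ τ' → Bdist a b < tripVal a b τ := by
  have hlt : ∀ τ, τ ≠ τ' → tripVal a b τ' < tripVal a b τ := fun τ hτ => by
    linarith [one_le_tripVal_add_tripVal a b hτ]
  have hmin : Bdist a b = tripVal a b τ' := by
    have : Nonempty ({M // M ∈ a.decA.carrier} ≃ {M // M ∈ b.decA.carrier}) := ⟨τ'⟩
    refine le_antisymm (ciInf_le (Set.finite_range _).bddBelow τ') (le_ciInf fun τ => ?_)
    obtain rfl | hτ := eq_or_ne τ τ'
    · exact le_rfl
    · exact (hlt τ hτ).le
  exact ⟨hmin, fun τ hτ => hmin ▸ hlt τ hτ⟩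
end
end

section
/- For every (𝒫,𝒬,σ) ∈ B_n there exists a unitary matrix U with U P U* = σ(P) for all P ∈ 𝒫 (so the projection p: E_n → B_n is surjective); moreover, for any such U, the map sending a family (z_P)_{P∈𝒫} of complex numbers of modulus 1 to ((𝒫,𝒬,σ), Σ_{P∈𝒫} z_P σ(P) U P) is a homeomorphism from the torus (S¹)^𝒫 onto the fiber p⁻¹((𝒫,𝒬,σ)). -/
noncomputable section

/-- `U` is a unitary matrix. -/
def IsUnitary {n : ℕ} (U : Mat n) : Prop :=
  U * U.conjTranspose = 1 ∧ U.conjTranspose * U = 1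

/-- Membership of `((𝒫,𝒬,σ), U)` in `E_n`: `U` is unitary and `U P U* = σ(P)`
for all `P ∈ 𝒫`. -/
def EnMem {n : ℕ} (a : Bn n) (U : Mat n) : Prop :=
  IsUnitary U ∧ ∀ P : {M // M ∈ a.decA.carrier},
    U * (P : Mat n) * U.conjTranspose = (a.bij P : Mat n)

/-- The metric topology on `B_n` generated by the balls of the distance `Bdist`. -/
noncomputable instance Bn.instTopologicalSpace {n : ℕ} : TopologicalSpace (Bn n) :=
  TopologicalSpace.generateFrom {s | ∃ (a : Bn n) (r : ℝ), s = {b | Bdist a b < r}}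

/-- The total space `E_n ⊆ B_n × U_n`, with the subspace topology. -/
abbrev En (n : ℕ) : Type := {x : Bn n × Mat n // EnMem x.1 x.2}

/-- The projection `p : E_n → B_n`. -/
def pEn {n : ℕ} (e : En n) : Bn n := e.1.1

open Matrix ComplexOrder in
/-- A rank-one orthogonal projection is `u uᴴ` for a unit vector `u`. -/
theorem exists_eq_vecMulVec_of_rank_one {n : ℕ} {P : Mat n} (hh : Pᴴ = P) (hi : P * P = P)
    (hr : P.rank = 1) : ∃ u : Fin n → ℂ, P = vecMulVec u (star u) ∧ star u ⬝ᵥ u = 1 := by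
  obtain ⟨⟨v, hv⟩, hv0, hspan⟩ := finrank_eq_one_iff'.mp hr
  have hv0' : v ≠ 0 := fun h => hv0 (Subtype.ext h)
  obtain ⟨c, hc⟩ : ∃ c : Fin n → ℂ, P = vecMulVec v c := by
    have h : ∀ j, ∃ c : ℂ, c • v = P.col j := by
      intro j
      obtain ⟨c, hc⟩ := hspan ⟨P.col j, by
        rw [LinearMap.mem_range]
        exact ⟨Pi.single j 1, by simp⟩⟩
      exact ⟨c, congrArg Subtype.val hc⟩
    choose c hc using h
    refine ⟨c, ?_⟩
    ext i j
    have := congrFun (hc j) i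
    simp only [Pi.smul_apply, smul_eq_mul, col_apply] at this
    rw [vecMulVec_apply, ← this, mul_comm]
  have hPv : P *ᵥ v = v := by
    obtain ⟨w, rfl⟩ := hv
    simp [hi]
  set t : ℂ := star v ⬝ᵥ v with ht
  have htpos : 0 < t := dotProduct_star_self_pos_iff.mpr hv0'
  have hPt : t • P = vecMulVec v (star v) := by
    have h1 : star v ᵥ* P = star v := by
      have := congrArg star hPv
      rwa [star_mulVec, hh] at this
    have h2 : t • c = star v := by
      rw [← h1, hc, vecMul_vecMulVec]
    rw [← h2, hc, vecMulVec_smul]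
  obtain ⟨r, hr0, hrt⟩ : ∃ r : ℝ, 0 < r ∧ (r : ℂ) = t := by
    obtain ⟨h1, h2⟩ := Complex.pos_iff.mp htpos
    exact ⟨t.re, h1, Complex.ext rfl (by simpa using h2)⟩
  have hsq : ((Real.sqrt r)⁻¹ : ℝ) * ((Real.sqrt r)⁻¹ : ℝ) = r⁻¹ := by
    rw [← mul_inv, Real.mul_self_sqrt hr0.le]
  have hsq' : (((Real.sqrt r)⁻¹ : ℝ) : ℂ) * (((Real.sqrt r)⁻¹ : ℝ) : ℂ) = t⁻¹ := by
    rw [← Complex.ofReal_mul, hsq, ← hrt, Complex.ofReal_inv]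
  have hstar : star ((((Real.sqrt r)⁻¹ : ℝ) : ℂ)) = (((Real.sqrt r)⁻¹ : ℝ) : ℂ) :=
    Complex.conj_ofReal _
  refine ⟨(((Real.sqrt r)⁻¹ : ℝ) : ℂ) • v, ?_, ?_⟩
  · rw [star_smul, hstar, smul_vecMulVec, vecMulVec_smul, smul_smul, hsq', ← hPt, smul_smul,
      inv_mul_cancel₀ htpos.ne', one_smul]
  · rw [star_smul, hstar, smul_dotProduct, dotProduct_smul, smul_smul, hsq', ← ht, smul_eq_mul,
      inv_mul_cancel₀ htpos.ne']

open Matrix in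
theorem mul_mul_self_eq_trace_smul_of_rank_one {n : ℕ} {P : Mat n} (hh : Pᴴ = P) (hi : P * P = P)
    (hr : P.rank = 1) (A : Mat n) : P * A * P = (A * P).trace • P := by
  obtain ⟨u, rfl, -⟩ := exists_eq_vecMulVec_of_rank_one hh hi hr
  rw [Matrix.mul_assoc, mul_vecMulVec, vecMulVec_mul_vecMulVec, trace_vecMulVec, vecMulVec_smul,
    dotProduct_comm]

open Matrix in
theorem trace_eq_one_of_rank_one {n : ℕ} {P : Mat n} (hh : Pᴴ = P) (hi : P * P = P)
    (hr : P.rank = 1) : P.trace = 1 := by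
  obtain ⟨u, rfl, hu⟩ := exists_eq_vecMulVec_of_rank_one hh hi hr
  rw [trace_vecMulVec, dotProduct_comm, hu]

open Matrix in
/-- Two rank-one orthogonal projections are related by a partial isometry. -/
theorem exists_partialIsometry_of_rank_one {n : ℕ} {P Q : Mat n}
    (hPh : Pᴴ = P) (hPi : P * P = P) (hPr : P.rank = 1)
    (hQh : Qᴴ = Q) (hQi : Q * Q = Q) (hQr : Q.rank = 1) :
    ∃ M : Mat n, M * Mᴴ = Q ∧ Mᴴ * M = P ∧ Q * M = M ∧ M * P = M := by
  obtain ⟨u, rfl, hu⟩ := exists_eq_vecMulVec_of_rank_one hPh hPi hPr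
  obtain ⟨w, rfl, hw⟩ := exists_eq_vecMulVec_of_rank_one hQh hQi hQr
  refine ⟨vecMulVec w (star u), ?_, ?_, ?_, ?_⟩ <;>
    simp [vecMulVec_mul_vecMulVec, conjTranspose_vecMulVec, hu, hw]

open Matrix in
theorem OrthDecomp.sum_smul_mul {n : ℕ} (D : OrthDecomp n)
    (f : {M // M ∈ D.carrier} → Mat n) (P : {M // M ∈ D.carrier}) :
    (∑ Q, f Q * (Q : Mat n)) * (P : Mat n) = f P * (P : Mat n) := by
  rw [Finset.sum_mul, Finset.sum_eq_single P]
  · rw [Matrix.mul_assoc, D.idem _ P.2]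
  · intro Q _ hQ
    rw [Matrix.mul_assoc, D.orth _ Q.2 _ P.2 (fun h => hQ (Subtype.ext h)), Matrix.mul_zero]
  · simp

theorem OrthDecomp.sum_subtype_eq {n : ℕ} (D : OrthDecomp n) :
    (∑ P : {M // M ∈ D.carrier}, (P : Mat n)) = 1 := by
  rw [← D.sum_eq]
  exact Finset.sum_coe_sort D.carrier (fun P => P)

open Matrix in
theorem Bn.exists_enMem {n : ℕ} (a : Bn n) : ∃ U : Mat n, EnMem a U := by
  have h : ∀ P : {M // M ∈ a.decA.carrier}, ∃ M : Mat n,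
      M * Mᴴ = (a.bij P : Mat n) ∧ Mᴴ * M = (P : Mat n) ∧
        (a.bij P : Mat n) * M = M ∧ M * (P : Mat n) = M := fun P =>
    exists_partialIsometry_of_rank_one
      (a.decA.herm _ P.2) (a.decA.idem _ P.2) (a.decA.rank_one _ P.2)
      (a.decB.herm _ (a.bij P).2) (a.decB.idem _ (a.bij P).2) (a.decB.rank_one _ (a.bij P).2)
  choose M hQ hP hQM hMP using h
  have hUP : ∀ P : {M // M ∈ a.decA.carrier}, (∑ Q, M Q) * (P : Mat n) = M P := by
    intro P
    have := a.decA.sum_smul_mul M P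
    simpa only [hMP] using this
  have hMU : ∀ P, (M P)ᴴ * (∑ Q, M Q) = (P : Mat n) := by
    intro P
    rw [Finset.mul_sum, Finset.sum_eq_single P]
    · exact hP P
    · intro Q _ hne
      have hne' : (a.bij P : Mat n) ≠ (a.bij Q : Mat n) := fun h =>
        hne (a.bij.injective (Subtype.ext h)).symm
      rw [← hQM P, ← hQM Q, conjTranspose_mul, a.decB.herm _ (a.bij P).2, Matrix.mul_assoc,
        ← Matrix.mul_assoc (a.bij P : Mat n), a.decB.orth _ (a.bij P).2 _ (a.bij Q).2 hne',
        Matrix.zero_mul, Matrix.mul_zero]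
    · simp
  have hiso : (∑ Q, M Q)ᴴ * (∑ Q, M Q) = 1 := by
    rw [conjTranspose_sum, Finset.sum_mul]
    simp only [hMU]
    exact a.decA.sum_subtype_eq
  refine ⟨∑ Q, M Q, ⟨mul_eq_one_comm.mp hiso, hiso⟩, fun P => ?_⟩
  have hPU : (P : Mat n) * (∑ Q, M Q)ᴴ = (M P)ᴴ := by
    rw [← hUP P, conjTranspose_mul, a.decA.herm _ P.2]
  rw [← a.decA.idem _ P.2, ← Matrix.mul_assoc, hUP, Matrix.mul_assoc, hPU, hQ]

open Matrix in
theorem EnMem.mul_eq {n : ℕ} {a : Bn n} {U : Mat n} (hU : EnMem a U)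
    (P : {M // M ∈ a.decA.carrier}) : (a.bij P : Mat n) * U = U * (P : Mat n) := by
  rw [← hU.2 P, Matrix.mul_assoc, hU.1.2, Matrix.mul_one]

open Matrix in
theorem EnMem.mul_mul_eq {n : ℕ} {a : Bn n} {U : Mat n} (hU : EnMem a U)
    (P : {M // M ∈ a.decA.carrier}) :
    (a.bij P : Mat n) * U * (P : Mat n) = U * (P : Mat n) := by
  rw [hU.mul_eq, Matrix.mul_assoc, a.decA.idem _ P.2]

open Matrix in
/-- Two unitaries implementing the same `σ` differ on each line by a scalar. -/
theorem EnMem.conjTranspose_mul_mul_eq {n : ℕ} {a : Bn n} {U W : Mat n} (hU : EnMem a U)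
    (hW : EnMem a W) (P : {M // M ∈ a.decA.carrier}) :
    Uᴴ * W * (P : Mat n) = (Uᴴ * W * (P : Mat n)).trace • (P : Mat n) := by
  rw [← mul_mul_self_eq_trace_smul_of_rank_one (a.decA.herm _ P.2) (a.decA.idem _ P.2)
    (a.decA.rank_one _ P.2)]
  have h : (P : Mat n) * Uᴴ = Uᴴ * (a.bij P : Mat n) := by
    have := congrArg conjTranspose (hU.mul_eq P)
    rw [conjTranspose_mul, conjTranspose_mul, a.decA.herm _ P.2,
      a.decB.herm _ (a.bij P).2] at this
    exact this.symm
  rw [← Matrix.mul_assoc (P : Mat n), h, Matrix.mul_assoc Uᴴ (a.bij P : Mat n), Matrix.mul_assoc Uᴴ,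
    hW.mul_eq, Matrix.mul_assoc, Matrix.mul_assoc W, a.decA.idem _ P.2]

open Matrix in
theorem EnMem.norm_trace_eq_one {n : ℕ} {a : Bn n} {U W : Mat n} (hU : EnMem a U)
    (hW : EnMem a W) (P : {M // M ∈ a.decA.carrier}) :
    ‖(Uᴴ * W * (P : Mat n)).trace‖ = 1 := by
  have h := hU.conjTranspose_mul_mul_eq hW P
  set z : ℂ := (Uᴴ * W * (P : Mat n)).trace
  have h1 : (Uᴴ * W * (P : Mat n))ᴴ * (Uᴴ * W * (P : Mat n)) = P := by
    have hV : (Uᴴ * W)ᴴ * (Uᴴ * W) = 1 := by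
      rw [conjTranspose_mul, conjTranspose_conjTranspose, Matrix.mul_assoc,
        ← Matrix.mul_assoc U, hU.1.1, Matrix.one_mul, hW.1.2]
    rw [conjTranspose_mul, Matrix.mul_assoc, ← Matrix.mul_assoc _ (Uᴴ * W), hV, Matrix.one_mul,
      a.decA.herm _ P.2, a.decA.idem _ P.2]
  rw [h, conjTranspose_smul, a.decA.herm _ P.2, smul_mul_smul_comm, a.decA.idem _ P.2] at h1
  have h2 := congrArg trace h1
  rw [trace_smul, trace_eq_one_of_rank_one (a.decA.herm _ P.2) (a.decA.idem _ P.2)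
    (a.decA.rank_one _ P.2), smul_eq_mul, mul_one] at h2
  have h3 := congrArg norm h2
  rw [norm_mul, norm_star, norm_one] at h3
  nlinarith [norm_nonneg z]

open Matrix in
theorem EnMem.sum_smul_mul_mul {n : ℕ} {a : Bn n} {U : Mat n} (hU : EnMem a U)
    (z : {M // M ∈ a.decA.carrier} → ℂ) (P : {M // M ∈ a.decA.carrier}) :
    (∑ Q, z Q • ((a.bij Q : Mat n) * U * (Q : Mat n))) * (P : Mat n) =
      z P • (U * (P : Mat n)) := by
  have := a.decA.sum_smul_mul (fun Q => z Q • U) P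
  simpa only [hU.mul_mul_eq, smul_mul_assoc] using this

open Matrix in
theorem EnMem.sum_smul {n : ℕ} {a : Bn n} {U : Mat n} (hU : EnMem a U)
    (z : {M // M ∈ a.decA.carrier} → Metric.sphere (0 : ℂ) 1) :
    EnMem a (∑ P, (z P : ℂ) • ((a.bij P : Mat n) * U * (P : Mat n))) := by
  have hz : ∀ P, (z P : ℂ) * star (z P : ℂ) = 1 := fun P => by
    have h : ‖(z P : ℂ)‖ = 1 := by simp
    rw [Complex.star_def, Complex.mul_conj, Complex.normSq_eq_norm_sq, h]
    simp
  have hWP := hU.sum_smul_mul_mul (fun P => (z P : ℂ))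
  set W : Mat n := ∑ P, (z P : ℂ) • ((a.bij P : Mat n) * U * (P : Mat n))
  have hconj : ∀ P : {M // M ∈ a.decA.carrier}, W * (P : Mat n) * Wᴴ = (a.bij P : Mat n) := by
    intro P
    have hPW : (P : Mat n) * Wᴴ = star (z P : ℂ) • ((P : Mat n) * Uᴴ) := by
      have := congrArg conjTranspose (hWP P)
      rwa [conjTranspose_smul, conjTranspose_mul, conjTranspose_mul, a.decA.herm _ P.2] at this
    rw [← hU.2 P, ← a.decA.idem _ P.2, ← Matrix.mul_assoc, hWP, Matrix.mul_assoc, hPW,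
      smul_mul_smul_comm, hz, one_smul]
    simp only [Matrix.mul_assoc]
  have hone : W * Wᴴ = 1 := by
    have h : ∑ P : {M // M ∈ a.decA.carrier}, W * (P : Mat n) * Wᴴ = W * Wᴴ := by
      rw [← Finset.sum_mul, ← Finset.mul_sum, a.decA.sum_subtype_eq, Matrix.mul_one]
    rw [← h, ← a.decB.sum_subtype_eq, ← a.bij.sum_comp]
    exact Finset.sum_congr rfl fun P _ => hconj P
  exact ⟨⟨hone, mul_eq_one_comm.mp hone⟩, hconj⟩

open Matrix in
theorem EnMem.sum_trace_smul {n : ℕ} {a : Bn n} {U W : Mat n} (hU : EnMem a U)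
    (hW : EnMem a W) :
    ∑ P : {M // M ∈ a.decA.carrier},
      (Uᴴ * W * (P : Mat n)).trace • ((a.bij P : Mat n) * U * (P : Mat n)) = W := by
  have h : ∀ P : {M // M ∈ a.decA.carrier},
      (Uᴴ * W * (P : Mat n)).trace • ((a.bij P : Mat n) * U * (P : Mat n)) =
        W * (P : Mat n) := by
    intro P
    rw [hU.mul_mul_eq, ← mul_smul_comm, ← hU.conjTranspose_mul_mul_eq hW, ← Matrix.mul_assoc,
      ← Matrix.mul_assoc, hU.1.1, Matrix.one_mul]
  rw [Finset.sum_congr rfl fun P _ => h P, ← Finset.mul_sum, a.decA.sum_subtype_eq, Matrix.mul_one]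

theorem enMem_of_pEn_eq {n : ℕ} {a : Bn n} {e : En n} (h : pEn e = a) : EnMem a e.1.2 :=
  h ▸ e.2

open Matrix in
/-- The torus of phases is homeomorphic to the fiber of `p` over `a`. -/
def EnMem.torusHomeomorph {n : ℕ} {a : Bn n} {U : Mat n} (hU : EnMem a U) :
    ({M // M ∈ a.decA.carrier} → Metric.sphere (0 : ℂ) 1) ≃ₜ {e : En n // pEn e = a} where
  toFun z := ⟨⟨(a, ∑ P, (z P : ℂ) • ((a.bij P : Mat n) * U * (P : Mat n))), hU.sum_smul z⟩, rfl⟩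
  invFun e P := ⟨(Uᴴ * e.1.1.2 * (P : Mat n)).trace, by
    simpa using hU.norm_trace_eq_one (enMem_of_pEn_eq e.2) P⟩
  left_inv z := by
    funext P
    apply Subtype.ext
    dsimp only
    rw [Matrix.mul_assoc, hU.sum_smul_mul_mul (fun P => (z P : ℂ)), mul_smul_comm,
      ← Matrix.mul_assoc, hU.1.2, Matrix.one_mul, trace_smul,
      trace_eq_one_of_rank_one (a.decA.herm _ P.2) (a.decA.idem _ P.2) (a.decA.rank_one _ P.2),
      smul_eq_mul, mul_one]
  right_inv e := by
    apply Subtype.ext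
    apply Subtype.ext
    exact Prod.ext e.2.symm (hU.sum_trace_smul (enMem_of_pEn_eq e.2))
  continuous_toFun := by
    refine Continuous.subtype_mk (Continuous.subtype_mk (continuous_const.prodMk ?_) _) _
    fun_prop
  continuous_invFun := by
    refine continuous_pi fun P => Continuous.subtype_mk ?_ _
    have h : Continuous fun e : {e : En n // pEn e = a} => e.1.1.2 :=
      continuous_snd.comp (continuous_subtype_val.comp continuous_subtype_val)
    exact ((continuous_const.matrix_mul h).matrix_mul continuous_const).matrix_trace

/-- `p : E_n → B_n` is surjective, and for any unitary `U` with
`U P U* = σ(P)` for all `P ∈ 𝒫`, the map `(z_P) ↦ ((𝒫,𝒬,σ), Σ_P z_P σ(P) U P)` is a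
homeomorphism from the torus `(S¹)^𝒫` onto the fiber `p⁻¹((𝒫,𝒬,σ))`. -/
theorem fiber_homeo_torus {n : ℕ} (hn : 1 ≤ n) (a : Bn n) :
    (∃ U : Mat n, EnMem a U) ∧
    ∀ U : Mat n, EnMem a U →
      ∃ φ : ({M // M ∈ a.decA.carrier} → ↥(Metric.sphere (0 : ℂ) 1)) ≃ₜ
          {e : En n // pEn e = a},
        ∀ z : {M // M ∈ a.decA.carrier} → ↥(Metric.sphere (0 : ℂ) 1),
          ((φ z : En n) : Bn n × Mat n).2 =
            ∑ P : {M // M ∈ a.decA.carrier},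
              (z P : ℂ) • ((a.bij P : Mat n) * U * (P : Mat n)) := by
  exact ⟨a.exists_enMem, fun U hU => ⟨hU.torusHomeomorph, fun z => rfl⟩⟩
end
end

section
/- Let X be a topological space and let A and B in M_n(C(X)) be normal, multiplicity-free, and have the same characteristic polynomial. Then for every x ∈ X the set 𝒫(x) of orthogonal projections of ℂⁿ onto the eigenspaces of A(x) is an orthogonal decomposition of ℂⁿ (consisting of n pairwise orthogonal rank-one orthogonal projections summing to I), likewise the set 𝒬(x) of orthogonal projections onto the eigenspaces of B(x); the triple Φ_{A,B}(x) = (𝒫(x), 𝒬(x), σ_x) lies in B_n, where σ_x sends the projection onto the λ-eigenspace of A(x) to the projection onto the λ-eigenspace of B(x) for each eigenvalue λ; and the resulting map Φ_{A,B}: X → B_n is continuous with respect to the metric topology on B_n. -/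
noncomputable section

/-- `A` has `n` distinct eigenvalues: its characteristic polynomial has `n` roots
(with multiplicity) and they are pairwise distinct. -/
def MultFree {n : ℕ} (A : Mat n) : Prop :=
  Multiset.card (Matrix.charpoly A).roots = n ∧ (Matrix.charpoly A).roots.Nodup

/-- `P` is the orthogonal projection of `ℂⁿ` onto the `λ`-eigenspace of `A`:
`P` is Hermitian, idempotent, and its range is `ker (A − λI)`. -/
def IsSpectralProj {n : ℕ} (A : Mat n) (lam : ℂ) (P : Mat n) : Prop :=
  P.conjTranspose = P ∧ P * P = P ∧
    LinearMap.range (Matrix.mulVecLin P) =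
      LinearMap.ker (Matrix.mulVecLin (A - lam • 1))

/-- `Φ` is the map `Φ_{A,B} : X → B_n`: at each point, the first (resp. second)
decomposition consists of the nonzero spectral projections of `A x` (resp. `B x`),
and the bijection pairs spectral projections with the same eigenvalue. -/
def IsPhiAB {X : Type*} {n : ℕ} (A B : X → Mat n) (Φ : X → Bn n) : Prop :=
  ∀ x : X,
    ((Φ x).decA.carrier : Set (Mat n)) =
        {P | ∃ lam : ℂ, P ≠ 0 ∧ IsSpectralProj (A x) lam P} ∧
    ((Φ x).decB.carrier : Set (Mat n)) =
        {Q | ∃ lam : ℂ, Q ≠ 0 ∧ IsSpectralProj (B x) lam Q} ∧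
    ∀ (P : {M // M ∈ (Φ x).decA.carrier}) (lam : ℂ),
      IsSpectralProj (A x) lam (P : Mat n) →
        IsSpectralProj (B x) lam ((Φ x).bij P : Mat n)

section SpectralProjections

open Polynomial

open scoped ComplexOrder

/-- The set of eigenvalues of a matrix. -/
def eigvals {n : ℕ} (A : Mat n) : Finset ℂ := A.charpoly.roots.toFinset

/-- The spectral projection at `lam` of a diagonalizable matrix, as a Lagrange polynomial. -/
def specProj {n : ℕ} (A : Mat n) (lam : ℂ) : Mat n :=
  aeval A (Lagrange.basis (eigvals A) id lam)

variable {n : ℕ} {A : Mat n}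

theorem MultFree.card_eigvals (h : MultFree A) : (eigvals A).card = n := by
  rw [eigvals, Multiset.toFinset_card_of_nodup h.2, h.1]

theorem MultFree.charpoly_eq (h : MultFree A) :
    A.charpoly = ∏ μ ∈ eigvals A, (X - C μ) := by
  have h1 := prod_multiset_X_sub_C_of_monic_of_roots_card_eq A.charpoly_monic
    (by rw [h.1, Matrix.charpoly_natDegree_eq_dim, Fintype.card_fin])
  rw [Finset.prod_eq_multiset_prod, eigvals, Multiset.toFinset_val,
    Multiset.dedup_eq_self.2 h.2, h1]

theorem MultFree.aeval_eq_zero (h : MultFree A) {p : ℂ[X]}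
    (hp : ∀ μ ∈ eigvals A, p.eval μ = 0) : aeval A p = 0 := by
  have hd : A.charpoly ∣ p := by
    rw [h.charpoly_eq]
    refine Finset.prod_dvd_of_coprime ?_ fun μ hμ => dvd_iff_isRoot.2 (hp μ hμ)
    intro a _ b _ hab
    exact isCoprime_X_sub_C_of_isUnit_sub (sub_ne_zero.2 hab).isUnit
  obtain ⟨q, rfl⟩ := hd
  simp [Matrix.aeval_self_charpoly]

theorem MultFree.aeval_congr (h : MultFree A) {p q : ℂ[X]}
    (hp : ∀ μ ∈ eigvals A, p.eval μ = q.eval μ) : aeval A p = aeval A q := by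
  rw [← sub_eq_zero, ← map_sub]
  exact h.aeval_eq_zero fun μ hμ => by rw [eval_sub, hp μ hμ, sub_self]

theorem eval_basis_id {s : Finset ℂ} {a b : ℂ} (ha : a ∈ s) (hb : b ∈ s) :
    (Lagrange.basis s id a).eval b = if a = b then 1 else 0 := by
  split_ifs with hab
  · subst hab
    exact Lagrange.eval_basis_self (v := id) Function.injective_id.injOn ha
  · exact Lagrange.eval_basis_of_ne (v := id) hab hb

theorem MultFree.specProj_mul_self (h : MultFree A) {a : ℂ} (ha : a ∈ eigvals A) :
    specProj A a * specProj A a = specProj A a := by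
  simp only [specProj, ← map_mul]
  refine h.aeval_congr fun μ hμ => ?_
  simp [eval_basis_id ha hμ]

theorem MultFree.specProj_mul_of_ne (h : MultFree A) {a b : ℂ} (ha : a ∈ eigvals A)
    (hb : b ∈ eigvals A) (hab : a ≠ b) : specProj A a * specProj A b = 0 := by
  simp only [specProj, ← map_mul]
  refine h.aeval_eq_zero fun μ hμ => ?_
  rw [eval_mul, eval_basis_id ha hμ, eval_basis_id hb hμ]
  grind

theorem MultFree.sum_specProj (h : MultFree A) : ∑ a ∈ eigvals A, specProj A a = 1 := by
  simp only [specProj, ← map_sum]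
  rw [← map_one (aeval (R := ℂ) A)]
  refine h.aeval_congr fun μ hμ => ?_
  rw [eval_finsetSum, eval_one, Finset.sum_congr rfl fun a ha => eval_basis_id ha hμ]
  simp [hμ]

theorem MultFree.sub_mul_specProj (h : MultFree A) {a : ℂ} (ha : a ∈ eigvals A) :
    (A - a • 1) * specProj A a = 0 := by
  have : A - a • 1 = aeval A (X - C a) := by simp [Algebra.algebraMap_eq_smul_one]
  rw [this, specProj, ← map_mul]
  refine h.aeval_eq_zero fun μ hμ => ?_
  simp only [eval_mul, eval_basis_id ha hμ]
  split_ifs with hab <;> simp [hab]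

theorem specProj_mulVec {a : ℂ} (ha : a ∈ eigvals A) {v : Fin n → ℂ}
    (hv : (A - a • 1).mulVec v = 0) : (specProj A a).mulVec v = v := by
  have hd : (X - C a) ∣ Lagrange.basis (eigvals A) id a - 1 :=
    dvd_iff_isRoot.2 (by simp [IsRoot, eval_basis_id ha ha])
  obtain ⟨q, hq⟩ := hd
  have hA : A - a • 1 = aeval A (X - C a) := by simp [Algebra.algebraMap_eq_smul_one]
  have h1 : specProj A a - 1 = aeval A q * (A - a • 1) := by
    rw [hA, ← map_mul, mul_comm, ← hq, map_sub, map_one, specProj]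
  rw [← sub_eq_zero]
  calc _ = (specProj A a - 1).mulVec v := by rw [Matrix.sub_mulVec, Matrix.one_mulVec]
    _ = 0 := by rw [h1, ← Matrix.mulVec_mulVec, hv, Matrix.mulVec_zero]

theorem mem_eigvals_iff {a : ℂ} :
    a ∈ eigvals A ↔ ∃ v : Fin n → ℂ, v ≠ 0 ∧ (A - a • 1).mulVec v = 0 := by
  rw [Matrix.exists_mulVec_eq_zero_iff, eigvals, Multiset.mem_toFinset,
    mem_roots A.charpoly_monic.ne_zero, IsRoot, Matrix.eval_charpoly, ← neg_sub A, Matrix.det_neg]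
  simp [Matrix.smul_one_eq_diagonal]

theorem specProj_ne_zero {a : ℂ} (ha : a ∈ eigvals A) : specProj A a ≠ 0 := by
  intro h0
  obtain ⟨v, hv, hAv⟩ := mem_eigvals_iff.1 ha
  have := specProj_mulVec ha hAv
  rw [h0, Matrix.zero_mulVec] at this
  exact hv this.symm

theorem conjTranspose_eq_of_idempotent_of_normal {P : Mat n} (h1 : P * P = P)
    (h2 : Commute P P.conjTranspose) : P.conjTranspose = P := by
  have h4 : P.conjTranspose * P.conjTranspose = P.conjTranspose := by
    rw [← Matrix.conjTranspose_mul, h1]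
  have h3 : P.conjTranspose * (1 - P) = 0 := by
    rw [← Matrix.conjTranspose_mul_self_eq_zero]
    have : P * (P.conjTranspose * (1 - P)) = 0 := by
      rw [← mul_assoc, h2.eq, mul_assoc, mul_sub, mul_one, h1, sub_self, mul_zero]
    rw [Matrix.conjTranspose_mul, Matrix.conjTranspose_conjTranspose, mul_assoc, this, mul_zero]
  have h5 : P.conjTranspose = P.conjTranspose * P := by
    rwa [mul_sub, mul_one, sub_eq_zero] at h3
  calc P.conjTranspose = P.conjTranspose * P := h5
    _ = (P.conjTranspose * P).conjTranspose := by
      rw [Matrix.conjTranspose_mul, Matrix.conjTranspose_conjTranspose]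
    _ = P := by rw [← h5, Matrix.conjTranspose_conjTranspose]

theorem conjTranspose_aeval_commute (hA : Commute A A.conjTranspose) (p : ℂ[X]) :
    Commute (aeval A p) (aeval A p).conjTranspose := by
  have h1 : ∀ (B : Mat n), Commute A B → Commute (aeval A p) B := fun B hB => by
    induction p using Polynomial.induction_on' with
    | add p q hp hq => rw [map_add]; exact hp.add_left hq
    | monomial k c =>
      rw [aeval_monomial]
      exact Commute.mul_left (Algebra.commutes c B) (hB.pow_left k)
  have h2 : Commute A.conjTranspose (aeval A p) := (h1 _ hA).symm
  have h3 : Commute (aeval A p).conjTranspose A := by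
    have := h2.star_star
    simpa [Matrix.star_eq_conjTranspose, Matrix.conjTranspose_conjTranspose] using this.symm
  exact h1 _ h3.symm

theorem MultFree.isSpectralProj (h : MultFree A) (hA : A * A.conjTranspose = A.conjTranspose * A)
    {a : ℂ} (ha : a ∈ eigvals A) : IsSpectralProj A a (specProj A a) := by
  refine ⟨conjTranspose_eq_of_idempotent_of_normal (h.specProj_mul_self ha)
    (conjTranspose_aeval_commute hA _), h.specProj_mul_self ha, le_antisymm ?_ ?_⟩
  · rintro _ ⟨v, rfl⟩
    rw [LinearMap.mem_ker, Matrix.mulVecLin_apply, Matrix.mulVecLin_apply, Matrix.mulVec_mulVec,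
      h.sub_mul_specProj ha, Matrix.zero_mulVec]
  · intro v hv
    exact ⟨v, specProj_mulVec ha hv⟩

theorem MultFree.rank_specProj (h : MultFree A) {a : ℂ} (ha : a ∈ eigvals A) :
    (specProj A a).rank = 1 := by
  have htr : ∀ b ∈ eigvals A, (specProj A b).trace = ((specProj A b).rank : ℂ) := fun b hb => by
    have hid : IsIdempotentElem (Matrix.toLin' (specProj A b)) := by
      rw [IsIdempotentElem, Module.End.mul_eq_comp, ← Matrix.toLin'_mul, h.specProj_mul_self hb]
    rw [← Matrix.trace_toLin'_eq, (LinearMap.IsIdempotentElem.isProj_range _ hid).trace]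
    rfl
  have hsum : ∑ b ∈ eigvals A, (specProj A b).rank = ∑ b ∈ eigvals A, 1 := by
    rw [← Nat.cast_inj (R := ℂ), Nat.cast_sum, ← Finset.sum_congr rfl htr, ← Matrix.trace_sum,
      h.sum_specProj]
    simp [h.card_eigvals]
  have hpos : ∀ b ∈ eigvals A, 1 ≤ (specProj A b).rank := fun b hb => by
    rw [Nat.one_le_iff_ne_zero]
    intro h0
    refine specProj_ne_zero hb ?_
    rw [Matrix.rank, Submodule.finrank_eq_zero, LinearMap.range_eq_bot] at h0
    exact Matrix.toLin'.injective (h0.trans (map_zero _).symm)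
  exact ((Finset.sum_eq_sum_iff_of_le hpos).1 hsum.symm a ha).symm

theorem MultFree.specProj_injOn (h : MultFree A) :
    Set.InjOn (specProj A) (eigvals A) := by
  intro a ha b hb hab
  by_contra hne
  refine specProj_ne_zero ha ?_
  rw [← h.specProj_mul_self ha]
  nth_rw 2 [hab]
  exact h.specProj_mul_of_ne ha hb hne

theorem mul_eq_of_range_le {P Q : Mat n} (hP : P * P = P)
    (h : LinearMap.range Q.mulVecLin ≤ LinearMap.range P.mulVecLin) : P * Q = Q := by
  refine Matrix.toLin'.injective (LinearMap.ext fun v => ?_)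
  obtain ⟨w, hw⟩ := h ⟨v, rfl⟩
  simp only [Matrix.mulVecLin_apply] at hw
  rw [Matrix.toLin'_apply, Matrix.toLin'_apply, ← Matrix.mulVec_mulVec, ← hw,
    Matrix.mulVec_mulVec, hP]

theorem IsSpectralProj.eq {P Q : Mat n} {a : ℂ} (hP : IsSpectralProj A a P)
    (hQ : IsSpectralProj A a Q) : P = Q := by
  have h1 := mul_eq_of_range_le (P := P) (Q := Q) hP.2.1 (hQ.2.2.trans hP.2.2.symm).le
  have h2 := mul_eq_of_range_le (P := Q) (Q := P) hQ.2.1 (hP.2.2.trans hQ.2.2.symm).le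
  calc P = P.conjTranspose := hP.1.symm
    _ = (Q * P).conjTranspose := by rw [h2]
    _ = P * Q := by rw [Matrix.conjTranspose_mul, hP.1, hQ.1]
    _ = Q := h1

theorem IsSpectralProj.mem_eigvals {P : Mat n} {a : ℂ} (hP : IsSpectralProj A a P)
    (h0 : P ≠ 0) : a ∈ eigvals A := by
  by_contra hmem
  refine h0 ?_
  have hker : ∀ v, P.mulVec v = 0 := fun v => by
    by_contra hv
    have : P.mulVec v ∈ LinearMap.ker (A - a • 1).mulVecLin := hP.2.2 ▸ ⟨v, rfl⟩
    exact hmem (mem_eigvals_iff.2 ⟨_, hv, this⟩)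
  refine Matrix.toLin'.injective (LinearMap.ext fun v => ?_)
  simp [hker]

/-- The orthogonal decomposition given by the spectral projections of a normal multiplicity-free
matrix. -/
def MultFree.orthDecomp (h : MultFree A) (hA : A * A.conjTranspose = A.conjTranspose * A) :
    OrthDecomp n where
  carrier := (eigvals A).image (specProj A)
  card_eq := by rw [Finset.card_image_of_injOn h.specProj_injOn, h.card_eigvals]
  herm := Finset.forall_mem_image.2 fun _ ha => (h.isSpectralProj hA ha).1
  idem := Finset.forall_mem_image.2 fun _ ha => h.specProj_mul_self ha
  rank_one := Finset.forall_mem_image.2 fun _ ha => h.rank_specProj ha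
  orth := Finset.forall_mem_image.2 fun _ ha => Finset.forall_mem_image.2 fun _ hb hab =>
    h.specProj_mul_of_ne ha hb fun e => hab (e ▸ rfl)
  sum_eq := by rw [Finset.sum_image h.specProj_injOn, h.sum_specProj]

theorem MultFree.coe_carrier (h : MultFree A) (hA : A * A.conjTranspose = A.conjTranspose * A) :
    ((h.orthDecomp hA).carrier : Set (Mat n)) =
      {P | ∃ lam : ℂ, P ≠ 0 ∧ IsSpectralProj A lam P} := by
  ext P
  simp only [orthDecomp, Finset.coe_image, Set.mem_image, Finset.mem_coe, Set.mem_ofPred_eq]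
  constructor
  · rintro ⟨a, ha, rfl⟩
    exact ⟨a, specProj_ne_zero ha, h.isSpectralProj hA ha⟩
  · rintro ⟨a, h0, hP⟩
    have ha := hP.mem_eigvals h0
    exact ⟨a, ha, (h.isSpectralProj hA ha).eq hP⟩

/-- The bijection between the eigenvalues and the spectral projections of a normal
multiplicity-free matrix. -/
def MultFree.eigEquiv (h : MultFree A) (hA : A * A.conjTranspose = A.conjTranspose * A) :
    {a // a ∈ eigvals A} ≃ {M // M ∈ (h.orthDecomp hA).carrier} :=
  Equiv.ofBijective (fun a => ⟨specProj A a, Finset.mem_image_of_mem _ a.2⟩)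
    ⟨fun a b hab => Subtype.ext (h.specProj_injOn a.2 b.2 (Subtype.ext_iff.1 hab)), fun P => by
      obtain ⟨a, ha, hP⟩ := Finset.mem_image.1 P.2
      exact ⟨⟨a, ha⟩, Subtype.ext hP⟩⟩

theorem continuous_opNorm : Continuous (opNorm : Mat n → ℝ) :=
  (LinearMap.continuous_of_finiteDimensional
    (Matrix.toEuclideanCLM (𝕜 := ℂ) (n := Fin n)).toAlgEquiv.toLinearMap).norm

theorem opNorm_sub_le (P Q R : Mat n) : opNorm (P - R) ≤ opNorm (P - Q) + opNorm (Q - R) := by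
  simp only [opNorm, map_sub]
  exact norm_sub_le_norm_sub_add_norm_sub _ _ _

theorem MultFree.exists_dist_lt (h : MultFree A) {a : ℂ} {δ : ℝ} (hδ : 0 < δ)
    (ha : ‖A.charpoly.eval a‖ < δ ^ n) : ∃ μ ∈ eigvals A, dist μ a < δ := by
  by_contra! hfar
  refine ha.not_ge ?_
  rw [h.charpoly_eq, eval_prod, norm_prod]
  calc δ ^ n = ∏ _μ ∈ eigvals A, δ := by rw [Finset.prod_const, h.card_eigvals]
    _ ≤ _ := Finset.prod_le_prod (fun _ _ => hδ.le) fun μ hμ => by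
      simpa [dist_eq_norm, norm_sub_rev] using hfar μ hμ

theorem continuous_eval_charpoly (a : ℂ) : Continuous fun M : Mat n => M.charpoly.eval a := by
  simp only [Matrix.eval_charpoly]
  exact (continuous_const.sub continuous_id).matrix_det

theorem MultFree.exists_equiv_eigvals {M : Mat n} (hA : MultFree A) (hM : MultFree M) {δ : ℝ}
    (hδ : 0 < δ) (hsep : ∀ a ∈ eigvals A, ∀ b ∈ eigvals A, a ≠ b → 2 * δ ≤ dist a b)
    (hclose : ∀ a ∈ eigvals A, ‖M.charpoly.eval a‖ < δ ^ n) :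
    ∃ f : {a // a ∈ eigvals A} ≃ {a // a ∈ eigvals M}, ∀ a, dist (f a : ℂ) a < δ := by
  choose f hf hfd using fun a : {a // a ∈ eigvals A} => hM.exists_dist_lt hδ (hclose a a.2)
  have hinj : Function.Injective fun a => (⟨f a, hf a⟩ : {a // a ∈ eigvals M}) := by
    intro a b hab
    have hab' : f a = f b := Subtype.ext_iff.1 hab
    by_contra hne
    have h1 := hsep a a.2 b b.2 fun e => hne (Subtype.ext e)
    have h2 := dist_triangle_left (a : ℂ) b (f a)
    have h3 := hfd a
    have h4 := hfd b
    rw [← hab'] at h4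
    linarith
  have hcard : Fintype.card {a // a ∈ eigvals A} = Fintype.card {a // a ∈ eigvals M} := by
    simp [hA.card_eigvals, hM.card_eigvals]
  exact ⟨Equiv.ofBijective _ ((Fintype.bijective_iff_injective_and_card _).2 ⟨hinj, hcard⟩), hfd⟩

theorem exists_separation (s : Finset ℂ) :
    ∃ δ > 0, ∀ a ∈ s, ∀ b ∈ s, a ≠ b → 2 * δ ≤ dist a b := by
  rcases s.offDiag.eq_empty_or_nonempty with he | hne
  · refine ⟨1, one_pos, fun a ha b hb hab => ?_⟩
    have : (a, b) ∈ s.offDiag := Finset.mem_offDiag.2 ⟨ha, hb, hab⟩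
    simp [he] at this
  · obtain ⟨p, hp, hmin⟩ := s.offDiag.exists_min_image (fun p => dist p.1 p.2) hne
    have := dist_pos.2 (Finset.mem_offDiag.1 hp).2.2
    refine ⟨dist p.1 p.2 / 2, half_pos this, fun a ha b hb hab => ?_⟩
    have := hmin (a, b) (Finset.mem_offDiag.2 ⟨ha, hb, hab⟩)
    dsimp only at this
    linarith

/-- The value at `M` of the Lagrange polynomial at `i` with nodes `w`. -/
def lagrangeProj {ι : Type*} [Fintype ι] [DecidableEq ι] (M : Mat n) (w : ι → ℂ) (i : ι) : Mat n :=
  aeval M (Lagrange.basis Finset.univ w i)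

theorem continuousAt_lagrangeProj {ι : Type*} [Fintype ι] [DecidableEq ι] (M : Mat n)
    {w : ι → ℂ} (hw : Function.Injective w) (i : ι) :
    ContinuousAt (fun p : Mat n × (ι → ℂ) => lagrangeProj p.1 p.2 i) (M, w) := by
  suffices ∀ s : Finset ι, i ∉ s → ContinuousAt (fun p : Mat n × (ι → ℂ) =>
      aeval p.1 (∏ j ∈ s, Lagrange.basisDivisor (p.2 i) (p.2 j))) (M, w) from
    this _ (Finset.notMem_erase _ _)
  intro s
  induction s using Finset.induction_on with
  | empty => intro _; simpa using continuousAt_const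
  | insert j s hj ih =>
    intro hi
    rw [Finset.mem_insert, not_or] at hi
    have h2 : ContinuousAt (fun p : Mat n × (ι → ℂ) =>
        aeval p.1 (Lagrange.basisDivisor (p.2 i) (p.2 j))) (M, w) := by
      have hi' : ∀ k, ContinuousAt (fun p : Mat n × (ι → ℂ) => p.2 k) (M, w) := fun k => by
        fun_prop
      have hinv := ((hi' i).sub (hi' j)).inv₀ (sub_ne_zero.2 (hw.ne hi.1))
      simp only [Lagrange.basisDivisor, map_mul, map_sub, aeval_C, aeval_X,
        Algebra.algebraMap_eq_smul_one, smul_mul_assoc, one_mul]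
      exact hinv.smul (continuousAt_fst.sub ((hi' j).smul continuousAt_const))
    simp only [Finset.prod_insert hj, map_mul]
    exact h2.mul (ih hi.2)

theorem specProj_eq_lagrangeProj {ι : Type*} [Fintype ι] [DecidableEq ι]
    (f : ι ≃ {a // a ∈ eigvals A}) (i : ι) :
    specProj A (f i) = lagrangeProj A (fun j => (f j : ℂ)) i := by
  rw [specProj, lagrangeProj, Lagrange.basis, Lagrange.basis]
  congr 1
  symm
  refine Finset.prod_bij (fun j _ => (f j : ℂ)) ?_ ?_ ?_ fun _ _ => rfl
  · intro j hj
    refine Finset.mem_erase.2 ⟨?_, (f j).2⟩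
    exact fun h => (Finset.mem_erase.1 hj).1 (f.injective (Subtype.ext h))
  · exact fun j _ k _ h => f.injective (Subtype.ext h)
  · intro b hb
    obtain ⟨hne, hb⟩ := Finset.mem_erase.1 hb
    refine ⟨f.symm ⟨b, hb⟩, Finset.mem_erase.2 ⟨?_, Finset.mem_univ _⟩, by simp⟩
    rintro rfl
    simp at hne

theorem eventually_exists_equiv_specProj {X : Type*} [TopologicalSpace X] {A B : X → Mat n}
    (hA : Continuous A) (hB : Continuous B) (hAm : ∀ x, MultFree (A x))
    (he : ∀ x, eigvals (A x) = eigvals (B x)) (x₀ : X) {ε : ℝ} (hε : 0 < ε) :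
    ∀ᶠ x in nhds x₀, ∃ f : {a // a ∈ eigvals (A x₀)} ≃ {a // a ∈ eigvals (A x)},
      ∀ a : {a // a ∈ eigvals (A x₀)}, opNorm (specProj (A x₀) a - specProj (A x) (f a)) < ε ∧
        opNorm (specProj (B x₀) a - specProj (B x) (f a)) < ε := by
  have key : ∀ C : X → Mat n, Continuous C → (∀ x, eigvals (A x) = eigvals (C x)) →
      ∃ δ > 0, ∀ᶠ x in nhds x₀, ∀ f : {a // a ∈ eigvals (A x₀)} ≃ {a // a ∈ eigvals (A x)},
        (∀ a, dist (f a : ℂ) a < δ) →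
          ∀ a : {a // a ∈ eigvals (A x₀)}, opNorm (specProj (C x₀) a - specProj (C x) (f a)) < ε := by
    intro C hC heC
    have hG : ∀ x (f : {a // a ∈ eigvals (A x₀)} ≃ {a // a ∈ eigvals (A x)})
        (a : {a // a ∈ eigvals (A x₀)}),
        specProj (C x) (f a) = lagrangeProj (C x) (fun j => (f j : ℂ)) a := fun x f a =>
      specProj_eq_lagrangeProj (f.trans (Equiv.subtypeEquivRight fun _ => by rw [heC x])) a
    have h1 : ∀ᶠ p in nhds (C x₀, fun a : {a // a ∈ eigvals (A x₀)} => (a : ℂ)),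
        ∀ a : {a // a ∈ eigvals (A x₀)}, opNorm (specProj (C x₀) a - lagrangeProj p.1 p.2 a) < ε := by
      refine Filter.eventually_all.2 fun a => ?_
      have hc := continuous_opNorm.continuousAt.comp
        (continuousAt_const (y := specProj (C x₀) a) |>.sub
          (continuousAt_lagrangeProj (C x₀) Subtype.val_injective a))
      refine hc.eventually_lt continuousAt_const ?_
      have := hG x₀ (Equiv.refl _) a
      simp only [Equiv.refl_apply] at this
      simpa [← this, opNorm] using hε
    rw [nhds_prod_eq, Filter.eventually_prod_iff] at h1
    obtain ⟨p, hp, q, hq, hpq⟩ := h1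
    obtain ⟨δ, hδ, hball⟩ := Metric.eventually_nhds_iff.1 hq
    refine ⟨δ, hδ, ((hC.tendsto x₀).eventually hp).mono fun x hx f hf a => ?_⟩
    rw [hG x f a]
    exact hpq hx (hball ((dist_pi_lt_iff hδ).2 hf)) a
  obtain ⟨δ₁, hδ₁, h₁⟩ := key A hA fun _ => rfl
  obtain ⟨δ₂, hδ₂, h₂⟩ := key B hB he
  obtain ⟨δ₃, hδ₃, h₃⟩ := exists_separation (eigvals (A x₀))
  set δ := min δ₁ (min δ₂ δ₃)
  have hδ : 0 < δ := lt_min hδ₁ (lt_min hδ₂ hδ₃)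
  have hroots : ∀ᶠ x in nhds x₀, ∀ a ∈ eigvals (A x₀), ‖(A x).charpoly.eval a‖ < δ ^ n := by
    refine (Filter.eventually_all_finset _).2 fun a ha => ?_
    refine ((continuous_eval_charpoly a).comp hA).norm.continuousAt.eventually_lt
      continuousAt_const ?_
    have : (A x₀).charpoly.eval a = 0 :=
      (mem_roots (A x₀).charpoly_monic.ne_zero).1 (Multiset.mem_toFinset.1 ha)
    simpa [this] using pow_pos hδ n
  filter_upwards [h₁, h₂, hroots] with x hx₁ hx₂ hx₃
  obtain ⟨f, hf⟩ := (hAm x₀).exists_equiv_eigvals (hAm x) hδ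
    (fun a ha b hb hab => (mul_le_mul_of_nonneg_left
      ((min_le_right _ _).trans (min_le_right _ _)) zero_le_two).trans (h₃ a ha b hb hab)) hx₃
  exact ⟨f, fun a => ⟨hx₁ f (fun b => (hf b).trans_le (min_le_left _ _)) a,
    hx₂ f (fun b => (hf b).trans_le ((min_le_right _ _).trans (min_le_left _ _))) a⟩⟩

theorem tripVal_lt_iff (hn : 1 ≤ n) (a b : Bn n)
    (τ : {M // M ∈ a.decA.carrier} ≃ {M // M ∈ b.decA.carrier}) (r : ℝ) :
    tripVal a b τ < r ↔ ∀ P : {M // M ∈ a.decA.carrier},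
      opNorm ((P : Mat n) - (τ P : Mat n)) < r ∧
        opNorm ((a.bij P : Mat n) - (b.bij (τ P) : Mat n)) < r := by
  have : Nonempty {M // M ∈ a.decA.carrier} := by
    rw [← Fintype.card_pos_iff, Fintype.card_coe, a.decA.card_eq]
    exact hn
  simp only [← max_lt_iff]
  constructor
  · exact fun h P => (le_ciSup (f := fun P : {M // M ∈ a.decA.carrier} =>
      max (opNorm ((P : Mat n) - (τ P : Mat n)))
        (opNorm ((a.bij P : Mat n) - (b.bij (τ P) : Mat n))))
        (Set.finite_range _).bddAbove P).trans_lt h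
  · intro h
    obtain ⟨P, hP⟩ := exists_eq_ciSup_of_finite (f := fun P : {M // M ∈ a.decA.carrier} =>
      max (opNorm ((P : Mat n) - (τ P : Mat n)))
        (opNorm ((a.bij P : Mat n) - (b.bij (τ P) : Mat n))))
    exact hP.symm.trans_lt (h P)

theorem Bdist_lt_iff (a b : Bn n) (r : ℝ) : Bdist a b < r ↔ ∃ τ, tripVal a b τ < r := by
  have : Nonempty ({M // M ∈ a.decA.carrier} ≃ {M // M ∈ b.decA.carrier}) :=
    ⟨Finset.equivOfCardEq (a.decA.card_eq.trans b.decA.card_eq.symm)⟩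
  exact ⟨exists_lt_of_ciInf_lt, fun ⟨τ, hτ⟩ =>
    (ciInf_le (Set.finite_range _).bddBelow τ).trans_lt hτ⟩

/-- The point of `B_n` determined by two normal multiplicity-free matrices with the same
eigenvalues. -/
def specTriple {A B : Mat n} (hA : MultFree A) (hAn : A * A.conjTranspose = A.conjTranspose * A)
    (hB : MultFree B) (hBn : B * B.conjTranspose = B.conjTranspose * B)
    (he : eigvals A = eigvals B) : Bn n where
  decA := hA.orthDecomp hAn
  decB := hB.orthDecomp hBn
  bij := (hA.eigEquiv hAn).symm.trans
    ((Equiv.subtypeEquivRight fun _ => by rw [he]).trans (hB.eigEquiv hBn))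

theorem coe_specTriple_bij {A B : Mat n} (hA : MultFree A)
    (hAn : A * A.conjTranspose = A.conjTranspose * A)
    (hB : MultFree B) (hBn : B * B.conjTranspose = B.conjTranspose * B)
    (he : eigvals A = eigvals B) (a : {a // a ∈ eigvals A}) :
    ((specTriple hA hAn hB hBn he).bij (hA.eigEquiv hAn a) : Mat n) = specProj B a := by
  change ((hB.eigEquiv hBn (Equiv.subtypeEquivRight _ ((hA.eigEquiv hAn).symm
    (hA.eigEquiv hAn a))) : Mat n)) = _
  rw [Equiv.symm_apply_apply]
  rfl

end SpectralProjections

/-- for normal multiplicity-free `A, B ∈ M_n(C(X))` with the same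
characteristic polynomial, the spectral projections of `A(x)` and of `B(x)` form
orthogonal decompositions of `ℂⁿ`, the triple `(𝒫(x), 𝒬(x), σ_x)` lies in `B_n`, and
the resulting map `Φ_{A,B} : X → B_n` is continuous. -/
theorem PhiAB_exists_continuous {X : Type*} [TopologicalSpace X] {n : ℕ} (hn : 1 ≤ n)
    (A B : X → Mat n) (hA : Continuous A) (hB : Continuous B)
    (hAn : ∀ x, A x * (A x).conjTranspose = (A x).conjTranspose * A x)
    (hBn : ∀ x, B x * (B x).conjTranspose = (B x).conjTranspose * B x)
    (hAm : ∀ x, MultFree (A x)) (hBm : ∀ x, MultFree (B x))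
    (hchar : ∀ x, Matrix.charpoly (A x) = Matrix.charpoly (B x)) :
    ∃ Φ : X → Bn n, Continuous Φ ∧ IsPhiAB A B Φ := by
  have he : ∀ x, eigvals (A x) = eigvals (B x) := fun x => by rw [eigvals, hchar x, eigvals]
  obtain ⟨Φ, e, heA, heB, hΦA, hΦB⟩ : ∃ (Φ : X → Bn n)
      (e : ∀ x, {a // a ∈ eigvals (A x)} ≃ {M // M ∈ (Φ x).decA.carrier}),
      (∀ x a, (e x a : Mat n) = specProj (A x) a) ∧
      (∀ x a, ((Φ x).bij (e x a) : Mat n) = specProj (B x) a) ∧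
      (∀ x, ((Φ x).decA.carrier : Set (Mat n)) =
        {P | ∃ lam : ℂ, P ≠ 0 ∧ IsSpectralProj (A x) lam P}) ∧
      ∀ x, ((Φ x).decB.carrier : Set (Mat n)) =
        {Q | ∃ lam : ℂ, Q ≠ 0 ∧ IsSpectralProj (B x) lam Q} :=
    ⟨fun x => specTriple (hAm x) (hAn x) (hBm x) (hBn x) (he x),
      fun x => (hAm x).eigEquiv (hAn x), fun _ _ => rfl,
      fun x a => coe_specTriple_bij (hAm x) (hAn x) (hBm x) (hBn x) (he x) a,
      fun x => (hAm x).coe_carrier (hAn x), fun x => (hBm x).coe_carrier (hBn x)⟩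
  refine ⟨Φ, ?_, fun x => ⟨hΦA x, hΦB x, fun P lam hP => ?_⟩⟩
  · refine continuous_generateFrom_iff.2 ?_
    rintro _ ⟨b, r, rfl⟩
    refine isOpen_iff_mem_nhds.2 fun x₀ hx₀ => ?_
    obtain ⟨τ, hτ⟩ := (Bdist_lt_iff _ _ _).1 hx₀
    obtain ⟨s, hs, hsr⟩ := exists_between hτ
    rw [tripVal_lt_iff hn] at hs
    filter_upwards [eventually_exists_equiv_specProj hA hB hAm he x₀ (sub_pos.2 hsr)]
      with x ⟨f, hf⟩
    refine (Bdist_lt_iff _ _ _).2 ⟨τ.trans ((e x₀).symm.trans (f.trans (e x))),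
      (tripVal_lt_iff hn _ _ _ _).2 fun P => ?_⟩
    obtain ⟨a, ha⟩ := (e x₀).surjective (τ P)
    have h1 := hs P
    have h2 := hf a
    rw [← ha, heB, heA] at h1
    simp only [Equiv.trans_apply]
    rw [← ha, Equiv.symm_apply_apply, heB, heA]
    exact ⟨(opNorm_sub_le _ _ _).trans_lt (by linarith [h1.1, h2.1]),
      (opNorm_sub_le _ _ _).trans_lt (by linarith [h1.2, h2.2])⟩
  · obtain ⟨a, rfl⟩ := (e x).surjective P
    rw [heA] at hP
    have ha : lam ∈ eigvals (A x) := hP.mem_eigvals (specProj_ne_zero a.2)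
    have hal : (a : ℂ) = lam := (hAm x).specProj_injOn a.2 ha
      (hP.eq ((hAm x).isSpectralProj (hAn x) ha))
    rw [heB, hal]
    exact (hBm x).isSpectralProj (hBn x) (he x ▸ ha)
end
end

section
/- Let X be a topological space and let A and B in M_n(C(X)) be normal, multiplicity-free, and have the same characteristic polynomial. Then A and B are unitarily equivalent if and only if the map Φ_{A,B}: X → B_n lifts through p: E_n → B_n, i.e., if and only if there exists a continuous map Φ̃_{A,B}: X → E_n with p ∘ Φ̃_{A,B} = Φ_{A,B}. -/
noncomputable section

/-- A vector lies in the eigenspace exactly when the spectral projection fixes it. -/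
theorem IsSpectralProj.mulVec_eq_self_iff {n : ℕ} {A P : Mat n} {lam : ℂ}
    (h : IsSpectralProj A lam P) (v : Fin n → ℂ) :
    P.mulVec v = v ↔ A.mulVec v = lam • v := by
  obtain ⟨-, hidem, hrange⟩ := h
  have hker : v ∈ LinearMap.ker (Matrix.mulVecLin (A - lam • 1)) ↔ A.mulVec v = lam • v := by
    rw [LinearMap.mem_ker, Matrix.mulVecLin_apply, Matrix.sub_mulVec, Matrix.smul_mulVec,
      Matrix.one_mulVec, sub_eq_zero]
  rw [← hker, ← hrange]
  constructor
  · exact fun hv => ⟨v, hv⟩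
  · rintro ⟨w, rfl⟩
    simp [Matrix.mulVec_mulVec, hidem]

theorem isSpectralProj_of_mulVec_eq_self_iff {n : ℕ} {A P : Mat n} {lam : ℂ}
    (hherm : P.conjTranspose = P) (hidem : P * P = P)
    (h : ∀ v, P.mulVec v = v ↔ A.mulVec v = lam • v) : IsSpectralProj A lam P := by
  refine ⟨hherm, hidem, ?_⟩
  ext v
  rw [LinearMap.mem_ker, Matrix.mulVecLin_apply, Matrix.sub_mulVec, Matrix.smul_mulVec,
    Matrix.one_mulVec, sub_eq_zero, ← h]
  constructor
  · rintro ⟨w, rfl⟩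
    simp [Matrix.mulVec_mulVec, hidem]
  · exact fun hv => ⟨v, hv⟩

theorem IsSpectralProj.mul_eq_smul {n : ℕ} {A P : Mat n} {lam : ℂ}
    (h : IsSpectralProj A lam P) : A * P = lam • P := by
  apply Matrix.ext_of_mulVec_single
  intro i
  rw [← Matrix.mulVec_mulVec, Matrix.smul_mulVec, ← h.mulVec_eq_self_iff,
    Matrix.mulVec_mulVec, h.2.1]

theorem IsSpectralProj.mul_eq_right {n : ℕ} {A P Q : Mat n} {lam : ℂ}
    (hP : IsSpectralProj A lam P) (hQ : IsSpectralProj A lam Q) : P * Q = Q := by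
  apply Matrix.ext_of_mulVec_single
  intro i
  rw [← Matrix.mulVec_mulVec, hP.mulVec_eq_self_iff, ← hQ.mulVec_eq_self_iff,
    Matrix.mulVec_mulVec, hQ.2.1]

theorem IsSpectralProj.unique {n : ℕ} {A P Q : Mat n} {lam : ℂ}
    (hP : IsSpectralProj A lam P) (hQ : IsSpectralProj A lam Q) : P = Q := by
  have h := congrArg Matrix.conjTranspose (hP.mul_eq_right hQ)
  rw [Matrix.conjTranspose_mul, hP.1, hQ.1, hQ.mul_eq_right hP] at h
  exact h

theorem IsSpectralProj.conj {n : ℕ} {A P U : Mat n} {lam : ℂ}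
    (hP : IsSpectralProj A lam P) (hU : IsUnitary U) :
    IsSpectralProj (U * A * U.conjTranspose) lam (U * P * U.conjTranspose) := by
  obtain ⟨hU₁, hU₂⟩ := hU
  have key (M : Mat n) (c : ℂ) (v : Fin n → ℂ) :
      (U * M * U.conjTranspose).mulVec v = c • v ↔
        M.mulVec (U.conjTranspose.mulVec v) = c • U.conjTranspose.mulVec v := by
    constructor <;> intro h
    · have := congrArg U.conjTranspose.mulVec h
      rwa [Matrix.mulVec_mulVec, ← mul_assoc, ← mul_assoc, hU₂, one_mul, Matrix.mulVec_smul,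
        ← Matrix.mulVec_mulVec] at this
    · rw [← Matrix.mulVec_mulVec, ← Matrix.mulVec_mulVec, h, Matrix.mulVec_smul,
        Matrix.mulVec_mulVec, hU₁, Matrix.one_mulVec]
  refine isSpectralProj_of_mulVec_eq_self_iff ?_ ?_ fun v => ?_
  · simp [Matrix.conjTranspose_mul, hP.1, mul_assoc]
  · calc U * P * U.conjTranspose * (U * P * U.conjTranspose)
        = U * P * (U.conjTranspose * U) * P * U.conjTranspose := by simp only [mul_assoc]
      _ = U * P * U.conjTranspose := by rw [hU₂, mul_one, mul_assoc U P P, hP.2.1]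
  · rw [key A, ← hP.mulVec_eq_self_iff]
    simpa using key P 1 v

theorem OrthDecomp.sum_attach {n : ℕ} (D : OrthDecomp n) :
    ∑ P : {M // M ∈ D.carrier}, (P : Mat n) = 1 := by
  rw [← D.sum_eq]
  exact D.carrier.sum_coe_sort id

/-- A unitary carrying each spectral projection of `A` to the spectral projection of `B`
with the same eigenvalue conjugates `A` to `B`. -/
theorem EnMem.conj_eq {n : ℕ} {A B U : Mat n} {a : Bn n} (hU : EnMem a U)
    (hspec : ∀ P : {M // M ∈ a.decA.carrier}, ∃ lam : ℂ,
      IsSpectralProj A lam P ∧ IsSpectralProj B lam (a.bij P)) :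
    U * A * U.conjTranspose = B := by
  choose lam hA hB using hspec
  have hsumA : A = ∑ P : {M // M ∈ a.decA.carrier}, lam P • (P : Mat n) := by
    conv_lhs => rw [← mul_one A, ← a.decA.sum_attach, Finset.mul_sum]
    exact Finset.sum_congr rfl fun P _ => (hA P).mul_eq_smul
  have hsumB : B = ∑ P : {M // M ∈ a.decA.carrier}, lam P • (a.bij P : Mat n) := by
    conv_lhs => rw [← mul_one B, ← a.decB.sum_attach, ← a.bij.sum_comp, Finset.mul_sum]
    exact Finset.sum_congr rfl fun P _ => (hB P).mul_eq_smul
  rw [hsumA, hsumB, Finset.mul_sum, Finset.sum_mul]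
  refine Finset.sum_congr rfl fun P _ => ?_
  rw [Matrix.mul_smul, Matrix.smul_mul, hU.2 P]


/-- normal multiplicity-free `A, B ∈ M_n(C(X))` with the same
characteristic polynomial are unitarily equivalent iff `Φ_{A,B} : X → B_n` lifts to a
continuous map `Φ̃_{A,B} : X → E_n` with `p ∘ Φ̃_{A,B} = Φ_{A,B}`. -/
theorem unitarily_equivalent_iff_lifts {X : Type*} [TopologicalSpace X] {n : ℕ}
    (hn : 1 ≤ n)
    (A B : X → Mat n) (hA : Continuous A) (hB : Continuous B)
    (hAn : ∀ x, A x * (A x).conjTranspose = (A x).conjTranspose * A x)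
    (hBn : ∀ x, B x * (B x).conjTranspose = (B x).conjTranspose * B x)
    (hAm : ∀ x, MultFree (A x)) (hBm : ∀ x, MultFree (B x))
    (hchar : ∀ x, Matrix.charpoly (A x) = Matrix.charpoly (B x))
    (Φ : X → Bn n) (hΦ : Continuous Φ) (hΦAB : IsPhiAB A B Φ) :
    (∃ U : X → Mat n, Continuous U ∧
        ∀ x, IsUnitary (U x) ∧ U x * A x * (U x).conjTranspose = B x) ↔
      ∃ L : X → En n, Continuous L ∧ ∀ x, pEn (L x) = Φ x := by
  have hspec (x : X) (P : {M // M ∈ (Φ x).decA.carrier}) : ∃ lam : ℂ,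
      IsSpectralProj (A x) lam P ∧ IsSpectralProj (B x) lam ((Φ x).bij P) := by
    obtain ⟨hdec, -, hbij⟩ := hΦAB x
    have hP : (P : Mat n) ∈ ((Φ x).decA.carrier : Set (Mat n)) := P.2
    rw [hdec] at hP
    obtain ⟨lam, -, hlam⟩ := hP
    exact ⟨lam, hlam, hbij P lam hlam⟩
  constructor
  · rintro ⟨U, hUc, hU⟩
    refine ⟨fun x => ⟨(Φ x, U x), (hU x).1, fun P => ?_⟩,
      (hΦ.prodMk hUc).subtype_mk _, fun x => rfl⟩
    obtain ⟨lam, hP, hQ⟩ := hspec x P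
    have hconj := hP.conj (hU x).1
    rw [(hU x).2] at hconj
    exact hconj.unique hQ
  · rintro ⟨L, hLc, hL⟩
    refine ⟨fun x => (L x).1.2, continuous_snd.comp (continuous_subtype_val.comp hLc),
      fun x => ?_⟩
    have hmem : EnMem (Φ x) (L x).1.2 := hL x ▸ (L x).2
    exact ⟨hmem.1, hmem.conj_eq (hspec x)⟩
end
end

section
/- Let S¹ = {z ∈ ℂ : |z| = 1} and define A: S¹ → M₂(ℂ) by A(z) = [[0, z],[1, 0]] (first row (0, z), second row (1, 0)). Then A(z) is normal with two distinct eigenvalues for every z ∈ S¹, and A is not diagonalizable over S¹: there is no continuous map U: S¹ → U₂(ℂ) into the 2-by-2 unitary matrices such that U(z)* A(z) U(z) is a diagonal matrix for every z ∈ S¹. -/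
noncomputable section

/-- The matrix `A(z) = [[0, z], [1, 0]]` over the circle. -/
noncomputable def Az (z : ↥(Metric.sphere (0 : ℂ) 1)) : Mat 2 :=
  !![0, (z : ℂ); 1, 0]

/-- The identity function on the unit circle has no continuous square root. -/
theorem not_exists_continuous_sqrt_circle :
    ¬ ∃ f : ↥(Metric.sphere (0 : ℂ) 1) → ℂ, Continuous f ∧ ∀ z, f z ^ 2 = z := by
  rintro ⟨f, hf, hsq⟩
  let g : ℝ → ℂ := fun t => Complex.exp (t / 2 * Complex.I)
  let e : ℝ → ↥(Metric.sphere (0 : ℂ) 1) := fun t =>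
    ⟨Complex.exp (t * Complex.I), by simp [Complex.norm_exp_ofReal_mul_I]⟩
  have he : Continuous e := by
    apply Continuous.subtype_mk
    fun_prop
  have hg : Continuous g := by fun_prop
  have hfg : Set.EqOn ((f ∘ e) ^ 2) (g ^ 2) Set.univ := by
    intro t _
    simp only [Pi.pow_apply, Function.comp_apply, hsq, e, g, ← Complex.exp_nat_mul]
    congr 1
    push_cast
    ring
  have hper : e (2 * Real.pi) = e 0 := by
    apply Subtype.ext
    simp [e, Complex.exp_two_pi_mul_I]
  have hg0 : g 0 = 1 := by simp [g]
  have hg1 : g (2 * Real.pi) = -1 := by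
    simp [g, Complex.exp_pi_mul_I]
  rcases isPreconnected_univ.eq_or_eq_neg_of_sq_eq (hf.comp he).continuousOn hg.continuousOn hfg
    (fun _ => Complex.exp_ne_zero _) with h | h
  all_goals
    have h0 := h (Set.mem_univ 0)
    have h1 := h (Set.mem_univ (2 * Real.pi))
    simp only [Function.comp_apply, Pi.neg_apply, hper, hg0, hg1] at h0 h1
    rw [h0] at h1
    norm_num at h1

theorem Az_mul_conjTranspose (z : ↥(Metric.sphere (0 : ℂ) 1)) :
    Az z * (Az z).conjTranspose = 1 := by
  have hz : (z : ℂ) * (starRingEnd ℂ) z = 1 := by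
    rw [Complex.mul_conj']
    simp
  ext i j
  fin_cases i <;> fin_cases j <;> simp [Az, Matrix.mul_apply, hz]

theorem Az_mul_self (z : ↥(Metric.sphere (0 : ℂ) 1)) : Az z * Az z = (z : ℂ) • 1 := by
  ext i j
  fin_cases i <;> fin_cases j <;> simp [Az, Matrix.mul_apply]

theorem multFree_Az (z : ↥(Metric.sphere (0 : ℂ) 1)) : MultFree (Az z) := by
  obtain ⟨w, hw⟩ := IsAlgClosed.exists_pow_nat_eq (z : ℂ) (n := 2) two_pos
  have hw0 : w ≠ 0 := by
    rintro rfl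
    exact ne_zero_of_mem_unit_sphere z (by simpa using hw.symm)
  have hchar : (Az z).charpoly =
      (({w, -w} : Multiset ℂ).map fun a => Polynomial.X - Polynomial.C a).prod := by
    rw [Matrix.charpoly_fin_two]
    simp [Az, Matrix.trace_fin_two, Matrix.det_fin_two, ← hw]
    ring
  rw [MultFree, hchar, Polynomial.roots_multiset_prod_X_sub_C]
  simpa [eq_neg_iff_add_eq_zero, ← two_mul] using hw0

/-- `A(z) = [[0,z],[1,0]]` is normal with two distinct eigenvalues for
every `z ∈ S¹`, but there is no continuous family of unitaries diagonalizing it. -/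
theorem Az_normal_not_diagonalizable :
    (∀ z : ↥(Metric.sphere (0 : ℂ) 1),
      Az z * (Az z).conjTranspose = (Az z).conjTranspose * Az z ∧ MultFree (Az z)) ∧
    ¬ ∃ U : ↥(Metric.sphere (0 : ℂ) 1) → Mat 2,
        Continuous U ∧
          ∀ z, IsUnitary (U z) ∧ ((U z).conjTranspose * Az z * U z).IsDiag := by
  refine ⟨fun z => ⟨?_, multFree_Az z⟩, ?_⟩
  · rw [Az_mul_conjTranspose, mul_eq_one_comm.mp (Az_mul_conjTranspose z)]
  rintro ⟨U, hU, h⟩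
  have hA : Continuous Az := by
    refine continuous_matrix fun i j => ?_
    fin_cases i <;> fin_cases j <;> simp [Az] <;> fun_prop
  refine not_exists_continuous_sqrt_circle
    ⟨fun z => ((U z).conjTranspose * Az z * U z) 0 0, ?_, fun z => ?_⟩
  · exact ((hU.matrix_conjTranspose.matrix_mul hA).matrix_mul hU).matrix_elem 0 0
  obtain ⟨⟨hU1, hU2⟩, hD⟩ := h z
  have hsq : ((U z).conjTranspose * Az z * U z) * ((U z).conjTranspose * Az z * U z) =
      (z : ℂ) • 1 := by
    calc _ = (U z).conjTranspose * Az z * (U z * (U z).conjTranspose) * Az z * U z := by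
          simp only [mul_assoc]
      _ = (U z).conjTranspose * (Az z * Az z) * U z := by
          rw [hU1, mul_one]
          simp only [mul_assoc]
      _ = _ := by simp [Az_mul_self, hU2]
  have h01 := hD (show (0 : Fin 2) ≠ 1 by decide)
  have h00 := congrFun (congrFun hsq 0) 0
  rw [Matrix.mul_apply, Fin.sum_univ_two, h01] at h00
  simpa [sq] using h00
end
end

section
/- Define A: ℝ → M₂(ℂ) by A(x) = [[x, 0],[0, 0]] for x ≤ 0 and A(x) = [[x, x],[x, x]] for x ≥ 0. Then A is continuous and A(x) is normal for every real x, but there is no continuous map U: ℝ → U₂(ℂ) into the 2-by-2 unitary matrices such that U(x)* A(x) U(x) is a diagonal matrix for every x ∈ ℝ. -/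
noncomputable section

/-- The matrix family `A(x)` over `ℝ`: `[[x,0],[0,0]]` for `x ≤ 0` and
`[[x,x],[x,x]]` for `x ≥ 0`. -/
noncomputable def Aex (x : ℝ) : Mat 2 :=
  if x ≤ 0 then !![(x : ℂ), 0; 0, 0] else !![(x : ℂ), (x : ℂ); (x : ℂ), (x : ℂ)]

theorem continuous_Aex : Continuous Aex := by
  unfold Aex
  refine Continuous.if_le ?_ ?_ continuous_id continuous_const ?_
  · refine continuous_matrix fun i j => ?_
    fin_cases i <;> fin_cases j <;> simp <;> fun_prop
  · refine continuous_matrix fun i j => ?_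
    fin_cases i <;> fin_cases j <;> simp <;> fun_prop
  · rintro x rfl
    ext i j
    fin_cases i <;> fin_cases j <;> simp

theorem Aex_mul_conjTranspose_comm (x : ℝ) :
    Aex x * (Aex x).conjTranspose = (Aex x).conjTranspose * Aex x := by
  have h : (Aex x).conjTranspose = Aex x := by
    unfold Aex
    split_ifs <;> ext i j <;> fin_cases i <;> fin_cases j <;> simp
  rw [h]

/-- Matrices diagonalized by the same unitary commute. -/
theorem IsUnitary.commute_of_isDiag {n : ℕ} {U A B : Mat n} (hU : IsUnitary U)
    (hA : (U.conjTranspose * A * U).IsDiag) (hB : (U.conjTranspose * B * U).IsDiag) :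
    Commute A B := by
  have key (C D : Mat n) : C * D =
      U * ((U.conjTranspose * C * U) * (U.conjTranspose * D * U)) * U.conjTranspose := by
    calc C * D = (U * U.conjTranspose) * C * (U * U.conjTranspose) * D *
          (U * U.conjTranspose) := by simp [hU.1]
      _ = _ := by simp only [mul_assoc]
  have hcomm : Commute (U.conjTranspose * A * U) (U.conjTranspose * B * U) := by
    rw [← hA.diagonal_diag, ← hB.diagonal_diag]
    exact Matrix.commute_diagonal _ _
  rw [Commute, SemiconjBy, key A B, key B A, hcomm.eq]

/-- The points at which a continuous matrix family diagonalizes a fixed matrix form a closed set. -/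
theorem isClosed_setOf_conjugate_isDiag {X : Type*} [TopologicalSpace X] {n : ℕ} {U : X → Mat n}
    (hU : Continuous U) (A : Mat n) :
    IsClosed {x | ((U x).conjTranspose * A * U x).IsDiag} := by
  have hcont : Continuous fun x => (U x).conjTranspose * A * U x := by fun_prop
  simp only [Matrix.IsDiag, Pairwise, Set.ofPred_forall]
  exact isClosed_iInter fun i => isClosed_iInter fun j => isClosed_iInter fun _ =>
    isClosed_eq (hcont.matrix_elem i j) continuous_const

theorem isDiag_of_conjugate_smul {n : ℕ} {U A : Mat n} {c : ℂ} (hc : c ≠ 0)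
    (h : (U.conjTranspose * (c • A) * U).IsDiag) : (U.conjTranspose * A * U).IsDiag := by
  have := h.smul c⁻¹
  rwa [Matrix.mul_smul, Matrix.smul_mul, inv_smul_smul₀ hc] at this

theorem Aex_of_nonpos {x : ℝ} (hx : x ≤ 0) : Aex x = (x : ℂ) • !![1, 0; 0, 0] := by
  simp [Aex, hx]

theorem Aex_of_pos {x : ℝ} (hx : 0 < x) : Aex x = (x : ℂ) • !![1, 1; 1, 1] := by
  simp [Aex, hx.not_ge]

/-- `A` is continuous and pointwise normal, but no continuous family of
unitaries diagonalizes it. -/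
theorem Aex_normal_not_diagonalizable :
    Continuous Aex ∧
    (∀ x : ℝ, Aex x * (Aex x).conjTranspose = (Aex x).conjTranspose * Aex x) ∧
    ¬ ∃ U : ℝ → Mat 2,
        Continuous U ∧
          ∀ x : ℝ, IsUnitary (U x) ∧ ((U x).conjTranspose * Aex x * U x).IsDiag := by
  refine ⟨continuous_Aex, Aex_mul_conjTranspose_comm, ?_⟩
  rintro ⟨U, hU, h⟩
  have hneg : ((U 0).conjTranspose * !![1, 0; 0, 0] * U 0).IsDiag := by
    refine closure_minimal (s := Set.Iio (0 : ℝ)) (fun x (hx : x < 0) => ?_)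
      (isClosed_setOf_conjugate_isDiag hU _) (by simp)
    refine isDiag_of_conjugate_smul (c := x) (by exact_mod_cast hx.ne) ?_
    exact Aex_of_nonpos hx.le ▸ (h x).2
  have hpos : ((U 0).conjTranspose * !![1, 1; 1, 1] * U 0).IsDiag := by
    refine closure_minimal (s := Set.Ioi (0 : ℝ)) (fun x (hx : 0 < x) => ?_)
      (isClosed_setOf_conjugate_isDiag hU _) (by simp)
    refine isDiag_of_conjugate_smul (c := x) (by exact_mod_cast hx.ne') ?_
    exact Aex_of_pos hx ▸ (h x).2
  have hentry := congrFun₂ ((h 0).1.commute_of_isDiag hneg hpos).eq 0 1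
  simp [Matrix.mul_apply] at hentry
end
end
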